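/- arXiv:1905.07473 — 2 statements merged into one kernel-verified Lean document; each statement's English description precedes it below -/
import Mathlib

section
/- Under the hypotheses of Theorem 2 (real inner product space H; loss ℒ : H → ℝ with L-Lipschitz gradient g and bounded below by ℒ*; stochastic gradient oracle G on a probability space (Ω₀, μ₀) with relative bias bounded by δ ∈ [0,1) and variance bounded by σ² > 0 at every θ; SGD iterates θ_{n+1}(ω) = θ_n(ω) − γ·G(θ_n(ω), ω_n) on the product space Ω₀^N), let D = ℒ(θ₁) − ℒ* and take the constant stepsize γ = √(2·D/(N·L·σ²)). If in addition γ ≤ (1 − δ)/(L·(1 + δ)²), then E[ min_{1 ≤ n ≤ N+1} ‖g(θ_n)‖² ] ≤ (1/(1 − δ)) · √(8·D·L·σ²/N). -/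
open MeasureTheory

lemma descent_aux {H : Type*} [NormedAddCommGroup H] [InnerProductSpace ℝ H]
    (ℒ : H → ℝ) (g : H → H) (L : ℝ)
    (hgrad : ∀ θ, HasFDerivAt ℒ ((InnerProductSpace.toDualMap ℝ H) (g θ)) θ)
    (hLip : ∀ θ θ', ‖g θ - g θ'‖ ≤ L * ‖θ - θ'‖) (θ h : H) :
    ℒ (θ + h) ≤ ℒ θ + inner ℝ (g θ) h + L / 2 * ‖h‖ ^ 2 := by
  have hd : ∀ t : ℝ, HasDerivAt (fun t : ℝ => ℒ (θ + t • h) - t * inner ℝ (g θ) h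
      - L / 2 * ‖h‖ ^ 2 * t ^ 2)
      (inner ℝ (g (θ + t • h)) h - inner ℝ (g θ) h - L * ‖h‖ ^ 2 * t) t := by
    intro t
    have h1 : HasDerivAt (fun t : ℝ => θ + t • h) h t := by
      simpa using ((hasDerivAt_id t).smul_const h).const_add θ
    have h2 := (hgrad (θ + t • h)).comp_hasDerivAt t h1
    have h3 := (hasDerivAt_id t).mul_const (inner ℝ (g θ) h)
    have h4 := ((hasDerivAt_id t).pow 2).const_mul (L / 2 * ‖h‖ ^ 2)
    refine HasDerivAt.congr_deriv (h2.sub h3 |>.sub h4) ?_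
    simp
    ring
  have hanti : AntitoneOn (fun t : ℝ => ℒ (θ + t • h) - t * inner ℝ (g θ) h
      - L / 2 * ‖h‖ ^ 2 * t ^ 2) (Set.Ici 0) := by
    apply antitoneOn_of_deriv_nonpos (convex_Ici 0)
    · exact fun t _ => (hd t).continuousAt.continuousWithinAt
    · exact fun t _ => (hd t).differentiableAt.differentiableWithinAt
    · intro t ht
      rw [interior_Ici] at ht
      have ht' : 0 < t := ht
      rw [(hd t).deriv, ← inner_sub_left]
      have h1 := real_inner_le_norm (g (θ + t • h) - g θ) h
      have h2 := hLip (θ + t • h) θ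
      rw [add_sub_cancel_left, norm_smul, Real.norm_of_nonneg ht'.le] at h2
      have h3 := mul_le_mul_of_nonneg_right h2 (norm_nonneg h)
      nlinarith
  have := hanti (Set.mem_Ici.2 le_rfl) (Set.mem_Ici.2 zero_le_one) zero_le_one
  simp at this
  linarith

noncomputable def sgdSum {H : Type*} [NormedAddCommGroup H] [InnerProductSpace ℝ H] {Ω₀ : Type*}
    (g : H → H) (G : H → Ω₀ → H) (γ : ℝ) : (M : ℕ) → H → (Fin M → Ω₀) → ℝ
  | 0, _, _ => 0
  | M + 1, θ, ω => ‖g θ‖ ^ 2 + sgdSum g G γ M (θ - γ • G θ (ω 0)) (Fin.tail ω)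

lemma sgdSum_eq {H : Type*} [NormedAddCommGroup H] [InnerProductSpace ℝ H] {Ω₀ : Type*}
    (g : H → H) (G : H → Ω₀ → H) (γ : ℝ) (M : ℕ) : ∀ (x : ℕ → H) (ω : Fin M → Ω₀)
    (_ : ∀ n (h : n < M), x (n + 1) = x n - γ • G (x n) (ω ⟨n, h⟩)),
    sgdSum g G γ M (x 0) ω = ∑ n ∈ Finset.range M, ‖g (x n)‖ ^ 2 := by
  induction M with
  | zero => intros; simp [sgdSum]
  | succ M ih =>
    intro x ω hx
    rw [Finset.sum_range_succ', sgdSum, add_comm]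
    congr 1
    have h0 := hx 0 (by omega)
    have := ih (fun n => x (n + 1)) (Fin.tail ω) (fun n h => hx (n + 1) (by omega))
    rw [← this]
    simp only [h0]
    rfl

lemma one_step {H : Type*} [NormedAddCommGroup H] [InnerProductSpace ℝ H] [CompleteSpace H]
    (ℒ : H → ℝ) (g : H → H) (L : ℝ) (hL : 0 < L)
    (hgrad : ∀ θ, HasFDerivAt ℒ ((InnerProductSpace.toDualMap ℝ H) (g θ)) θ)
    (hLip : ∀ θ θ', ‖g θ - g θ'‖ ≤ L * ‖θ - θ'‖)
    (lstar : ℝ) (hbelow : ∀ θ, lstar ≤ ℒ θ)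
    (δ : ℝ) (hδ : δ ∈ Set.Ico (0 : ℝ) 1) (σ : ℝ)
    {Ω₀ : Type*} [MeasurableSpace Ω₀] (μ₀ : Measure Ω₀) [IsProbabilityMeasure μ₀]
    (G : H → Ω₀ → H) 
    (hG_int : ∀ θ, Integrable (G θ) μ₀)
    (hG_sq : ∀ θ, Integrable (fun ω₀ => ‖G θ ω₀‖ ^ 2) μ₀)
    (hbias : ∀ θ, ‖(∫ ω₀, G θ ω₀ ∂μ₀) - g θ‖ ≤ δ * ‖g θ‖)
    (hvar : ∀ θ, (∫ ω₀, ‖G θ ω₀ - ∫ ω₀', G θ ω₀' ∂μ₀‖ ^ 2 ∂μ₀) ≤ σ ^ 2)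
    (γ : ℝ) (hγ : 0 < γ) (hγ_le : γ ≤ (1 - δ) / (L * (1 + δ) ^ 2))
    (θ : H) (c a : ℝ) (hc : 0 ≤ c) (ha : a = 2 / (γ * (1 - δ))) :
    ∫⁻ ω₀, ENNReal.ofReal (c + ‖g θ‖ ^ 2 + a * (ℒ (θ - γ • G θ ω₀) - lstar)) ∂μ₀ ≤
      ENNReal.ofReal (c + a * (ℒ θ - lstar + L * γ ^ 2 * σ ^ 2 / 2)) := by
  obtain ⟨hδ0, hδ1⟩ := hδ
  have hδ' : 0 < 1 - δ := by linarith
  have ha0 : 0 < a := by rw [ha]; positivity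
  have haγ : a * (γ * (1 - δ)) = 2 := by rw [ha]; field_simp
  have hstep : γ * (L * (1 + δ) ^ 2) ≤ 1 - δ := by
    rwa [le_div_iff₀ (by positivity)] at hγ_le
  set m := ∫ ω₀, G θ ω₀ ∂μ₀ with hm
  have hpt : ∀ ω₀, ℒ (θ - γ • G θ ω₀) ≤
      ℒ θ - γ * inner ℝ (g θ) (G θ ω₀) + L * γ ^ 2 / 2 * ‖G θ ω₀‖ ^ 2 := by
    intro ω₀
    have := descent_aux ℒ g L hgrad hLip θ (-(γ • G θ ω₀))
    rw [← sub_eq_add_neg, inner_neg_right, inner_smul_right, norm_neg, norm_smul, mul_pow,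
      Real.norm_eq_abs, sq_abs] at this
    nlinarith
  have hI1 : Integrable (fun ω₀ => inner ℝ (g θ) (G θ ω₀)) μ₀ := (hG_int θ).const_inner _
  have hI2 : Integrable (fun ω₀ => inner ℝ m (G θ ω₀)) μ₀ := (hG_int θ).const_inner _
  have hint : Integrable (fun ω₀ => (c + ‖g θ‖ ^ 2 + a * (ℒ θ - lstar))
      - (a * γ) * inner ℝ (g θ) (G θ ω₀) + (a * (L * γ ^ 2 / 2)) * ‖G θ ω₀‖ ^ 2) μ₀ :=
    ((integrable_const _).sub (hI1.const_mul _)).add ((hG_sq θ).const_mul _)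
  have hle : ∀ ω₀, c + ‖g θ‖ ^ 2 + a * (ℒ (θ - γ • G θ ω₀) - lstar) ≤
      (c + ‖g θ‖ ^ 2 + a * (ℒ θ - lstar))
      - (a * γ) * inner ℝ (g θ) (G θ ω₀) + (a * (L * γ ^ 2 / 2)) * ‖G θ ω₀‖ ^ 2 := by
    intro ω₀
    have := mul_le_mul_of_nonneg_left (hpt ω₀) ha0.le
    linarith
  have hnn : ∀ ω₀, 0 ≤ c + ‖g θ‖ ^ 2 + a * (ℒ (θ - γ • G θ ω₀) - lstar) := by
    intro ω₀
    have := mul_nonneg ha0.le (sub_nonneg.2 (hbelow (θ - γ • G θ ω₀)))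
    positivity
  refine (lintegral_mono fun ω₀ => ENNReal.ofReal_le_ofReal (hle ω₀)).trans ?_
  rw [← ofReal_integral_eq_lintegral_ofReal hint
    (Filter.Eventually.of_forall fun ω₀ => (hnn ω₀).trans (hle ω₀))]
  apply ENNReal.ofReal_le_ofReal
  have hI3 : Integrable (fun ω₀ => (c + ‖g θ‖ ^ 2 + a * (ℒ θ - lstar))
      - (a * γ) * inner ℝ (g θ) (G θ ω₀)) μ₀ := (integrable_const _).sub (hI1.const_mul _)
  rw [integral_add hI3 ((hG_sq θ).const_mul _),
    integral_sub (integrable_const _) (hI1.const_mul _), integral_const_mul, integral_const_mul,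
    integral_inner (hG_int θ), integral_const, probReal_univ, one_smul, ← hm]
  have hv : ∫ ω₀, ‖G θ ω₀ - m‖ ^ 2 ∂μ₀ = (∫ ω₀, ‖G θ ω₀‖ ^ 2 ∂μ₀) - ‖m‖ ^ 2 := by
    have : ∀ ω₀, ‖G θ ω₀ - m‖ ^ 2 = ‖G θ ω₀‖ ^ 2 - 2 * inner ℝ m (G θ ω₀) + ‖m‖ ^ 2 := by
      intro ω₀
      rw [norm_sub_sq_real, real_inner_comm]
    simp only [this]
    have hI4 : Integrable (fun ω₀ => ‖G θ ω₀‖ ^ 2 - 2 * inner ℝ m (G θ ω₀)) μ₀ :=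
      (hG_sq θ).sub (hI2.const_mul _)
    rw [integral_add hI4 (integrable_const _),
      integral_sub (hG_sq θ) (hI2.const_mul _), integral_const_mul,
      integral_inner (hG_int θ), integral_const, probReal_univ, one_smul, ← hm,
      real_inner_self_eq_norm_sq]
    ring
  have hv2 : (∫ ω₀, ‖G θ ω₀‖ ^ 2 ∂μ₀) ≤ σ ^ 2 + ‖m‖ ^ 2 := by
    have := hvar θ
    rw [← hm, hv] at this
    linarith
  have hb := hbias θ
  rw [← hm] at hb
  have hg0 := norm_nonneg (g θ)
  have hm1 : ‖m‖ ≤ (1 + δ) * ‖g θ‖ := by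
    have := norm_add_le (m - g θ) (g θ)
    rw [sub_add_cancel] at this
    linarith
  have hm2 : ‖m‖ ^ 2 ≤ (1 + δ) ^ 2 * ‖g θ‖ ^ 2 := by
    rw [← mul_pow]; exact pow_le_pow_left₀ (norm_nonneg _) hm1 2
  have hin : (1 - δ) * ‖g θ‖ ^ 2 ≤ inner ℝ (g θ) m := by
    have h1 : inner ℝ (g θ) m = inner ℝ (g θ) (m - g θ) + ‖g θ‖ ^ 2 := by
      rw [inner_sub_right, real_inner_self_eq_norm_sq]; ring
    have h2 := neg_le_of_abs_le (abs_real_inner_le_norm (g θ) (m - g θ))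
    nlinarith
  have e1 := mul_le_mul_of_nonneg_left hin (mul_pos ha0 hγ).le
  have e2 := mul_le_mul_of_nonneg_left (hv2.trans (add_le_add_right hm2 _))
    (show 0 ≤ a * (L * γ ^ 2 / 2) by positivity)
  have e3 := mul_le_mul_of_nonneg_left hstep (show 0 ≤ a * γ / 2 * ‖g θ‖ ^ 2 by positivity)
  have e4 : a * (γ * (1 - δ)) * ‖g θ‖ ^ 2 = 2 * ‖g θ‖ ^ 2 := by rw [haγ]
  nlinarith

lemma multi_step {H : Type*} [NormedAddCommGroup H] [InnerProductSpace ℝ H] [CompleteSpace H]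
    (ℒ : H → ℝ) (g : H → H) (L : ℝ) (hL : 0 < L)
    (hgrad : ∀ θ, HasFDerivAt ℒ ((InnerProductSpace.toDualMap ℝ H) (g θ)) θ)
    (hLip : ∀ θ θ', ‖g θ - g θ'‖ ≤ L * ‖θ - θ'‖)
    (lstar : ℝ) (hbelow : ∀ θ, lstar ≤ ℒ θ)
    (δ : ℝ) (hδ : δ ∈ Set.Ico (0 : ℝ) 1) (σ : ℝ)
    {Ω₀ : Type*} [MeasurableSpace Ω₀] (μ₀ : Measure Ω₀) [IsProbabilityMeasure μ₀]
    (G : H → Ω₀ → H) 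
    (hG_int : ∀ θ, Integrable (G θ) μ₀)
    (hG_sq : ∀ θ, Integrable (fun ω₀ => ‖G θ ω₀‖ ^ 2) μ₀)
    (hbias : ∀ θ, ‖(∫ ω₀, G θ ω₀ ∂μ₀) - g θ‖ ≤ δ * ‖g θ‖)
    (hvar : ∀ θ, (∫ ω₀, ‖G θ ω₀ - ∫ ω₀', G θ ω₀' ∂μ₀‖ ^ 2 ∂μ₀) ≤ σ ^ 2)
    (γ : ℝ) (hγ : 0 < γ) (hγ_le : γ ≤ (1 - δ) / (L * (1 + δ) ^ 2))
    (a : ℝ) (ha : a = 2 / (γ * (1 - δ))) (M : ℕ) : ∀ (θ : H) (c : ℝ) (_ : 0 ≤ c),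
    ∫⁻ ω, ENNReal.ofReal (c + sgdSum g G γ M θ ω) ∂(Measure.pi fun _ : Fin M => μ₀) ≤
      ENNReal.ofReal (c + a * (ℒ θ - lstar + M * (L * γ ^ 2 * σ ^ 2 / 2))) := by
  have hδ' : 0 < 1 - δ := by linarith [hδ.2]
  have ha0 : 0 < a := by rw [ha]; positivity
  induction M with
  | zero =>
    intro θ c hc
    simp only [sgdSum, lintegral_const, measure_univ, mul_one]
    apply ENNReal.ofReal_le_ofReal
    have := mul_nonneg ha0.le (sub_nonneg.2 (hbelow θ))
    simp; linarith
  | succ M ih =>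
    intro θ c hc
    obtain ⟨f, hf, hfle, hfeq⟩ := exists_measurable_le_lintegral_eq
      (Measure.pi fun _ : Fin (M + 1) => μ₀) (fun ω => ENNReal.ofReal (c + sgdSum g G γ (M + 1) θ ω))
    rw [hfeq]
    have hmp := (measurePreserving_piFinSuccAbove (fun _ : Fin (M + 1) => μ₀) 0).symm
    rw [← hmp.lintegral_comp hf, lintegral_prod (fun z => f ((MeasurableEquiv.piFinSuccAbove (fun _ => Ω₀) 0).symm z))
      (hf.comp hmp.measurable).aemeasurable]
    have hstep := one_step ℒ g L hL hgrad hLip lstar hbelow δ hδ σ μ₀ G hG_int hG_sq hbias hvar γ hγ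
      hγ_le θ (c + a * (M * (L * γ ^ 2 * σ ^ 2 / 2))) a (by positivity) ha
    have hfin : c + a * (M * (L * γ ^ 2 * σ ^ 2 / 2)) + a * (ℒ θ - lstar + L * γ ^ 2 * σ ^ 2 / 2)
      = c + a * (ℒ θ - lstar + (M + 1 : ℕ) * (L * γ ^ 2 * σ ^ 2 / 2)) := by
      push_cast; ring
    rw [hfin] at hstep
    refine le_trans (lintegral_mono fun ω₀ => ?_) hstep
    have h1 := ih (θ - γ • G θ ω₀) (c + ‖g θ‖ ^ 2) (by positivity)
    have h2 : c + ‖g θ‖ ^ 2 + a * (ℒ (θ - γ • G θ ω₀) - lstar + M * (L * γ ^ 2 * σ ^ 2 / 2))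
      = c + a * (M * (L * γ ^ 2 * σ ^ 2 / 2)) + ‖g θ‖ ^ 2 + a * (ℒ (θ - γ • G θ ω₀) - lstar) := by
      ring
    rw [h2] at h1
    refine le_trans (lintegral_mono fun ω' => ?_) h1
    refine (hfle _).trans (le_of_eq ?_)
    simp [sgdSum, add_assoc, MeasurableEquiv.piFinSuccAbove, Fin.insertNthEquiv]

/-- Optimal constant-stepsize conclusion of Theorem 2: with the constant
stepsize `γ = √(2D/(NLσ²))` (assumed to satisfy `γ ≤ (1−δ)/(L(1+δ)²)`),
SGD with a `δ`-relatively-biased, `σ²`-variance-bounded stochastic gradient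
oracle satisfies `E[min_{1 ≤ n ≤ N+1} ‖g(θ_n)‖²] ≤ (1/(1−δ))·√(8DLσ²/N)`. -/
theorem sgd_biased_gradients_optimal_stepsize
    {H : Type*} [NormedAddCommGroup H] [InnerProductSpace ℝ H]
    [MeasurableSpace H] [BorelSpace H]
    (ℒ : H → ℝ) (g : H → H) (L : ℝ)
    (hgrad : ∀ θ, HasFDerivAt ℒ ((InnerProductSpace.toDualMap ℝ H) (g θ)) θ)
    (hLip : ∀ θ θ', ‖g θ - g θ'‖ ≤ L * ‖θ - θ'‖)
    (lstar : ℝ) (hbelow : ∀ θ, lstar ≤ ℒ θ)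
    (δ : ℝ) (hδ : δ ∈ Set.Ico (0 : ℝ) 1) (σ : ℝ) (hσ : 0 < σ)
    {Ω₀ : Type*} [MeasurableSpace Ω₀] (μ₀ : Measure Ω₀) [IsProbabilityMeasure μ₀]
    (G : H → Ω₀ → H) (hG_meas : Measurable (Function.uncurry G))
    (hG_int : ∀ θ, Integrable (G θ) μ₀)
    (hG_sq : ∀ θ, Integrable (fun ω₀ => ‖G θ ω₀‖ ^ 2) μ₀)
    (hbias : ∀ θ, ‖(∫ ω₀, G θ ω₀ ∂μ₀) - g θ‖ ≤ δ * ‖g θ‖)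
    (hvar : ∀ θ, (∫ ω₀, ‖G θ ω₀ - ∫ ω₀', G θ ω₀' ∂μ₀‖ ^ 2 ∂μ₀) ≤ σ ^ 2)
    (N : ℕ) (hN : 0 < N) (θ₁ : H)
    (D : ℝ) (hD : D = ℒ θ₁ - lstar)
    (γ : ℝ) (hγ : γ = Real.sqrt (2 * D / (N * L * σ ^ 2)))
    (hγ_le : γ ≤ (1 - δ) / (L * (1 + δ) ^ 2))
    (θseq : ℕ → (Fin N → Ω₀) → H)
    (hθ_init : ∀ ω, θseq 1 ω = θ₁)
    (hθ_step : ∀ n (h1 : 1 ≤ n) (h2 : n ≤ N), ∀ ω : Fin N → Ω₀,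
      θseq (n + 1) ω = θseq n ω - γ • G (θseq n ω) (ω ⟨n - 1, by omega⟩)) :
    (∫ ω, ((Finset.Icc 1 (N + 1)).inf' (Finset.nonempty_Icc.mpr (by omega))
        fun n => ‖g (θseq n ω)‖ ^ 2) ∂(Measure.pi fun _ : Fin N => μ₀)) ≤
      (1 / (1 - δ)) * Real.sqrt (8 * D * L * σ ^ 2 / N) := by
  have hne : (Finset.Icc 1 (N + 1)).Nonempty := Finset.nonempty_Icc.mpr (by omega)
  have hR : 0 ≤ (1 / (1 - δ)) * Real.sqrt (8 * D * L * σ ^ 2 / N) :=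
    mul_nonneg (one_div_nonneg.2 (by linarith [hδ.2])) (Real.sqrt_nonneg _)
  -- easy case: some iterate always has zero gradient
  have hzero : (g θ₁ = 0) → (∫ ω, ((Finset.Icc 1 (N + 1)).inf' hne
        fun n => ‖g (θseq n ω)‖ ^ 2) ∂(Measure.pi fun _ : Fin N => μ₀)) ≤
      (1 / (1 - δ)) * Real.sqrt (8 * D * L * σ ^ 2 / N) := by
    intro h0
    refine le_trans (integral_nonpos fun ω => ?_) hR
    refine (Finset.inf'_le _ (Finset.mem_Icc.2 ⟨le_rfl, by omega⟩ : 1 ∈ _)).trans ?_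
    simp [hθ_init, h0]
  by_cases hcomp : CompleteSpace H
  swap
  · apply hzero
    have h := hbias θ₁
    have h2 : (∫ ω₀, G θ₁ ω₀ ∂μ₀) = 0 := by
      rw [integral]; simp [hcomp]
    rw [h2, zero_sub, norm_neg] at h
    rw [← norm_le_zero_iff]
    nlinarith [hδ.2, norm_nonneg (g θ₁)]
  by_cases hg0 : g θ₁ = 0
  · exact hzero hg0
  have hgpos : 0 < ‖g θ₁‖ := norm_pos_iff.2 hg0
  have hL : 0 < L := by
    by_contra hL
    push Not at hL
    have hLip0 : ∀ θ θ', ‖g θ - g θ'‖ ≤ 0 * ‖θ - θ'‖ := fun θ θ' =>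
      (hLip θ θ').trans (mul_le_mul_of_nonneg_right hL (norm_nonneg _))
    have h := descent_aux ℒ g 0 hgrad hLip0 θ₁ (-((D + 1) / ‖g θ₁‖ ^ 2) • g θ₁)
    rw [inner_smul_right, real_inner_self_eq_norm_sq, neg_mul,
      div_mul_cancel₀ _ (by positivity)] at h
    have := hbelow (θ₁ + -((D + 1) / ‖g θ₁‖ ^ 2) • g θ₁)
    linarith
  have hDpos : 0 < D := by
    have h := descent_aux ℒ g L hgrad hLip θ₁ (-(1 / L) • g θ₁)
    rw [inner_smul_right, real_inner_self_eq_norm_sq, norm_smul, mul_pow, Real.norm_eq_abs,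
      sq_abs] at h
    have h1 := hbelow (θ₁ + -(1 / L) • g θ₁)
    have h2 : -(1 / L) * ‖g θ₁‖ ^ 2 + L / 2 * ((-(1 / L)) ^ 2 * ‖g θ₁‖ ^ 2)
      = - (‖g θ₁‖ ^ 2 / (2 * L)) := by field_simp; ring
    have h3 : 0 < ‖g θ₁‖ ^ 2 / (2 * L) := by positivity
    linarith
  have hNpos : (0 : ℝ) < N := by exact_mod_cast hN
  have hδ' : 0 < 1 - δ := by linarith [hδ.2]
  have hγpos : 0 < γ := by rw [hγ]; positivity
  have hγsq : γ ^ 2 * (N * L * σ ^ 2) = 2 * D := by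
    rw [hγ, Real.sq_sqrt (by positivity)]; field_simp
  have hms := multi_step ℒ g L hL hgrad hLip lstar hbelow δ hδ σ μ₀ G hG_int hG_sq hbias hvar γ
    hγpos hγ_le _ rfl N θ₁ 0 le_rfl
  have hpt : ∀ ω, N * ((Finset.Icc 1 (N + 1)).inf' hne fun n => ‖g (θseq n ω)‖ ^ 2) ≤
      0 + sgdSum g G γ N θ₁ ω := by
    intro ω
    have h := sgdSum_eq g G γ N (fun n => θseq (n + 1) ω) ω
      (fun n h => hθ_step (n + 1) (by omega) (by omega) ω)
    simp only [zero_add, hθ_init] at h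
    rw [zero_add, h]
    have h2 := Finset.card_nsmul_le_sum (Finset.range N) (fun n => ‖g (θseq (n + 1) ω)‖ ^ 2)
      ((Finset.Icc 1 (N + 1)).inf' hne fun n => ‖g (θseq n ω)‖ ^ 2) (fun n hn =>
        Finset.inf'_le (fun n => ‖g (θseq n ω)‖ ^ 2) (Finset.mem_Icc.2
          ⟨by omega, by have := Finset.mem_range.1 hn; omega⟩))
    simpa using h2
  have hnn : ∀ ω, 0 ≤ N * ((Finset.Icc 1 (N + 1)).inf' hne fun n => ‖g (θseq n ω)‖ ^ 2) := by
    intro ω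
    refine mul_nonneg hNpos.le ?_
    exact Finset.le_inf' _ _ fun n _ => by positivity
  have hkey : N * (∫ ω, ((Finset.Icc 1 (N + 1)).inf' hne
        fun n => ‖g (θseq n ω)‖ ^ 2) ∂(Measure.pi fun _ : Fin N => μ₀)) ≤
      2 / (γ * (1 - δ)) * (D + N * (L * γ ^ 2 * σ ^ 2 / 2)) := by
    rw [← integral_const_mul]
    by_cases hms' : AEStronglyMeasurable (fun ω => N * ((Finset.Icc 1 (N + 1)).inf' hne
        fun n => ‖g (θseq n ω)‖ ^ 2)) (Measure.pi fun _ : Fin N => μ₀)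
    · rw [integral_eq_lintegral_of_nonneg_ae (Filter.Eventually.of_forall hnn) hms']
      refine ENNReal.toReal_le_of_le_ofReal (by positivity) ?_
      refine (lintegral_mono fun ω => ENNReal.ofReal_le_ofReal (hpt ω)).trans ?_
      rwa [zero_add, ← hD] at hms
    · rw [integral_non_aestronglyMeasurable hms']
      positivity
  have hfin : 2 / (γ * (1 - δ)) * (D + N * (L * γ ^ 2 * σ ^ 2 / 2)) =
      N * ((1 / (1 - δ)) * Real.sqrt (8 * D * L * σ ^ 2 / N)) := by
    have hs : Real.sqrt (8 * D * L * σ ^ 2 / N) = 2 * L * σ ^ 2 * γ := by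
      rw [Real.sqrt_eq_iff_mul_self_eq (by positivity) (by positivity)]
      rw [div_eq_iff hNpos.ne']
      linear_combination (-(4 * L * σ ^ 2)) * hγsq
    rw [hs]
    have : D = γ ^ 2 * (N * L * σ ^ 2) / 2 := by linarith
    rw [this]
    field_simp
    ring
  rw [hfin] at hkey
  exact le_of_mul_le_mul_left hkey hNpos
end

section
/- Under the hypotheses of Theorem 2 (real inner product space H; loss ℒ : H → ℝ with L-Lipschitz gradient g and bounded below by ℒ*; stochastic gradient oracle G on a probability space (Ω₀, μ₀) with relative bias bounded by δ ∈ [0,1) and variance bounded by σ² at every θ; SGD iterates θ_{n+1}(ω) = θ_n(ω) − γ_n·G(θ_n(ω), ω_n) on the product space Ω₀^N), let D = ℒ(θ₁) − ℒ* and use the decaying stepsizes γ_n = γ·n^{−1/2} with 0 < γ ≤ (1 − δ)/(L·(1 + δ)²). Then E[ min_{1 ≤ n ≤ N+1} ‖g(θ_n)‖² ] ≤ (2·D + L·σ²·γ²·(1 + log N)) / ((1 − δ)·γ·√N). -/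
open MeasureTheory

lemma sgd_descent {H : Type*} [NormedAddCommGroup H] [InnerProductSpace ℝ H]
    (ℒ : H → ℝ) (g : H → H) (L : ℝ)
    (hgrad : ∀ θ, HasFDerivAt ℒ ((InnerProductSpace.toDualMap ℝ H) (g θ)) θ)
    (hLip : ∀ θ θ', ‖g θ - g θ'‖ ≤ L * ‖θ - θ'‖) (θ w : H) :
    ℒ (θ + w) ≤ ℒ θ + inner ℝ (g θ) w + L / 2 * ‖w‖ ^ 2 := by
  have hd : ∀ t : ℝ, HasDerivAt
      (fun t : ℝ => ℒ (θ + t • w) - t * inner ℝ (g θ) w - L / 2 * ‖w‖ ^ 2 * t ^ 2)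
      (inner ℝ (g (θ + t • w)) w - inner ℝ (g θ) w - L * ‖w‖ ^ 2 * t) t := by
    intro t
    have h1 : HasDerivAt (fun t : ℝ => θ + t • w) w t := by
      simpa using ((hasDerivAt_id t).smul_const w).const_add θ
    have h2 := (hgrad (θ + t • w)).comp_hasDerivAt t h1
    have h3 := (h2.sub ((hasDerivAt_id t).mul_const (inner ℝ (g θ) w))).sub
      (((hasDerivAt_id t).pow 2).const_mul (L / 2 * ‖w‖ ^ 2))
    refine h3.congr_deriv ?_
    simp
    ring
  have hanti : AntitoneOn
      (fun t : ℝ => ℒ (θ + t • w) - t * inner ℝ (g θ) w - L / 2 * ‖w‖ ^ 2 * t ^ 2)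
      (Set.Icc 0 1) := by
    apply antitoneOn_of_deriv_nonpos (convex_Icc 0 1)
    · exact fun t _ => (hd t).continuousAt.continuousWithinAt
    · exact fun t _ => (hd t).differentiableAt.differentiableWithinAt
    · intro t ht
      rw [interior_Icc] at ht
      rw [(hd t).deriv]
      have h1 := real_inner_le_norm (g (θ + t • w) - g θ) w
      rw [inner_sub_left] at h1
      have h2 := hLip (θ + t • w) θ
      rw [add_sub_cancel_left, norm_smul, Real.norm_of_nonneg ht.1.le] at h2
      nlinarith [norm_nonneg w, mul_le_mul_of_nonneg_right h2 (norm_nonneg w)]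
  have := hanti (Set.left_mem_Icc.2 zero_le_one) (Set.right_mem_Icc.2 zero_le_one) zero_le_one
  simp at this
  linarith

lemma sgd_step {H : Type*} [NormedAddCommGroup H] [InnerProductSpace ℝ H] [CompleteSpace H]
    (ℒ : H → ℝ) (g : H → H) (L : ℝ) (hL : 0 < L)
    (hgrad : ∀ θ, HasFDerivAt ℒ ((InnerProductSpace.toDualMap ℝ H) (g θ)) θ)
    (hLip : ∀ θ θ', ‖g θ - g θ'‖ ≤ L * ‖θ - θ'‖)
    (lstar : ℝ) (hbelow : ∀ θ, lstar ≤ ℒ θ)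
    (δ : ℝ) (hδ : δ ∈ Set.Ico (0 : ℝ) 1) (σ : ℝ)
    {Ω₀ : Type*} [MeasurableSpace Ω₀] (μ₀ : Measure Ω₀) [IsProbabilityMeasure μ₀]
    (G : H → Ω₀ → H)
    (hG_int : ∀ θ, Integrable (G θ) μ₀)
    (hG_sq : ∀ θ, Integrable (fun ω₀ => ‖G θ ω₀‖ ^ 2) μ₀)
    (hbias : ∀ θ, ‖(∫ ω₀, G θ ω₀ ∂μ₀) - g θ‖ ≤ δ * ‖g θ‖)
    (hvar : ∀ θ, (∫ ω₀, ‖G θ ω₀ - ∫ ω₀', G θ ω₀' ∂μ₀‖ ^ 2 ∂μ₀) ≤ σ ^ 2)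
    (γ : ℝ) (hγ_pos : 0 < γ) (hγ_le : γ * (L * (1 + δ) ^ 2) ≤ 1 - δ) (C : ℝ) (hC : 0 ≤ C)
    (θ : H) :
    ENNReal.ofReal (γ * ‖g θ‖ ^ 2) +
      ∫⁻ x, ENNReal.ofReal ((2 * (ℒ (θ - γ • G θ x) - lstar) + C) / (1 - δ)) ∂μ₀
      ≤ ENNReal.ofReal ((2 * (ℒ θ - lstar) + (L * σ ^ 2 * γ ^ 2 + C)) / (1 - δ)) := by
  obtain ⟨hδ0, hδ1⟩ := hδ
  have h1δ : 0 < 1 - δ := by linarith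
  set m := ∫ ω₀, G θ ω₀ ∂μ₀ with hm
  let U : Ω₀ → ℝ := fun x => ℒ θ - γ * inner ℝ (g θ) (G θ x) + L / 2 * γ ^ 2 * ‖G θ x‖ ^ 2
  have hU : ∀ x, ℒ (θ - γ • G θ x) ≤ U x := by
    intro x
    have := sgd_descent ℒ g L hgrad hLip θ (-(γ • G θ x))
    rw [← sub_eq_add_neg, inner_neg_right, inner_smul_right, norm_neg, norm_smul, mul_pow,
      Real.norm_eq_abs, sq_abs] at this
    simp only [U]
    linarith
  have hiin : Integrable (fun x => inner ℝ (g θ) (G θ x)) μ₀ := (hG_int θ).const_inner (g θ)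
  have hUint : Integrable U μ₀ :=
    ((integrable_const _).sub (hiin.const_mul γ)).add ((hG_sq θ).const_mul _)
  have hUI : ∫ x, U x ∂μ₀ = ℒ θ - γ * inner ℝ (g θ) m
      + L / 2 * γ ^ 2 * ∫ x, ‖G θ x‖ ^ 2 ∂μ₀ := by
    simp only [U]
    have i1 : Integrable (fun x => ℒ θ - γ * inner ℝ (g θ) (G θ x)) μ₀ :=
      (integrable_const _).sub (hiin.const_mul γ)
    rw [integral_add i1 ((hG_sq θ).const_mul _),
      integral_sub (integrable_const _) (hiin.const_mul γ), integral_const_mul,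
      integral_const_mul, integral_inner (hG_int θ)]
    simp [hm]
  have hsq : ∫ x, ‖G θ x‖ ^ 2 ∂μ₀ ≤ σ ^ 2 + ‖m‖ ^ 2 := by
    have h := hvar θ
    rw [← hm] at h
    have him : Integrable (fun x => inner ℝ m (G θ x)) μ₀ := (hG_int θ).const_inner m
    have e : ∀ x, ‖G θ x - m‖ ^ 2 = ‖G θ x‖ ^ 2 - 2 * inner ℝ m (G θ x) + ‖m‖ ^ 2 := by
      intro x
      rw [norm_sub_sq_real, real_inner_comm]
    simp_rw [e] at h
    have i1 : Integrable (fun x => ‖G θ x‖ ^ 2 - 2 * inner ℝ m (G θ x)) μ₀ :=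
      (hG_sq θ).sub (him.const_mul 2)
    rw [integral_add i1 (integrable_const _),
      integral_sub (hG_sq θ) (him.const_mul 2), integral_const_mul,
      integral_inner (hG_int θ), ← hm, real_inner_self_eq_norm_sq] at h
    simp at h
    linarith
  have hb := hbias θ
  rw [← hm] at hb
  have hin : (1 - δ) * ‖g θ‖ ^ 2 ≤ inner ℝ (g θ) m := by
    have h1 := neg_le_of_abs_le (abs_real_inner_le_norm (g θ) (m - g θ))
    rw [inner_sub_right, real_inner_self_eq_norm_sq] at h1
    nlinarith [mul_le_mul_of_nonneg_left hb (norm_nonneg (g θ))]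
  have hmn : ‖m‖ ^ 2 ≤ (1 + δ) ^ 2 * ‖g θ‖ ^ 2 := by
    rw [← mul_pow]
    apply pow_le_pow_left₀ (norm_nonneg _)
    have := norm_add_le (m - g θ) (g θ)
    rw [sub_add_cancel] at this
    linarith
  have hfin : ∫ x, U x ∂μ₀ ≤ ℒ θ - γ * (1 - δ) / 2 * ‖g θ‖ ^ 2 + L / 2 * γ ^ 2 * σ ^ 2 := by
    rw [hUI]
    have a1 := mul_le_mul_of_nonneg_left hin hγ_pos.le
    have a2 := mul_le_mul_of_nonneg_left (hsq.trans (add_le_add_right hmn _))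
      (by positivity : 0 ≤ L / 2 * γ ^ 2)
    have a3 := mul_le_mul_of_nonneg_left hγ_le (by positivity : 0 ≤ γ / 2 * ‖g θ‖ ^ 2)
    nlinarith
  have hVint : Integrable (fun x => (2 * (U x - lstar) + C) / (1 - δ)) μ₀ :=
    ((((hUint.sub (integrable_const _)).const_mul 2).add (integrable_const _)).div_const _)
  have hV0 : ∀ x, 0 ≤ (2 * (U x - lstar) + C) / (1 - δ) := by
    intro x
    have := hU x
    have := hbelow (θ - γ • G θ x)
    apply div_nonneg _ h1δ.le
    linarith
  have hVI : ∫ x, (2 * (U x - lstar) + C) / (1 - δ) ∂μ₀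
      = (2 * ((∫ x, U x ∂μ₀) - lstar) + C) / (1 - δ) := by
    have i1 : Integrable (fun x => 2 * (U x - lstar)) μ₀ :=
      (hUint.sub (integrable_const _)).const_mul 2
    rw [integral_div, integral_add i1
      (integrable_const _), integral_const_mul, integral_sub hUint (integrable_const _)]
    simp
  calc _ ≤ ENNReal.ofReal (γ * ‖g θ‖ ^ 2) +
      ∫⁻ x, ENNReal.ofReal ((2 * (U x - lstar) + C) / (1 - δ)) ∂μ₀ := by
        gcongr with x
        exact hU x
    _ = ENNReal.ofReal (γ * ‖g θ‖ ^ 2 + (2 * ((∫ x, U x ∂μ₀) - lstar) + C) / (1 - δ)) := by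
        rw [← ofReal_integral_eq_lintegral_ofReal hVint (Filter.Eventually.of_forall hV0),
          ENNReal.ofReal_add (by positivity) (by rw [← hVI]; exact integral_nonneg hV0), hVI]
    _ ≤ _ := by
        apply ENNReal.ofReal_le_ofReal
        rw [le_div_iff₀ h1δ, add_mul, div_mul_cancel₀ _ h1δ.ne']
        linarith

lemma sgd_main {H : Type*} [NormedAddCommGroup H] [InnerProductSpace ℝ H] [CompleteSpace H]
    (ℒ : H → ℝ) (g : H → H) (L : ℝ) (hL : 0 < L)
    (hgrad : ∀ θ, HasFDerivAt ℒ ((InnerProductSpace.toDualMap ℝ H) (g θ)) θ)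
    (hLip : ∀ θ θ', ‖g θ - g θ'‖ ≤ L * ‖θ - θ'‖)
    (lstar : ℝ) (hbelow : ∀ θ, lstar ≤ ℒ θ)
    (δ : ℝ) (hδ : δ ∈ Set.Ico (0 : ℝ) 1) (σ : ℝ)
    {Ω₀ : Type*} [MeasurableSpace Ω₀] (μ₀ : Measure Ω₀) [IsProbabilityMeasure μ₀]
    (G : H → Ω₀ → H)
    (hG_int : ∀ θ, Integrable (G θ) μ₀)
    (hG_sq : ∀ θ, Integrable (fun ω₀ => ‖G θ ω₀‖ ^ 2) μ₀)
    (hbias : ∀ θ, ‖(∫ ω₀, G θ ω₀ ∂μ₀) - g θ‖ ≤ δ * ‖g θ‖)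
    (hvar : ∀ θ, (∫ ω₀, ‖G θ ω₀ - ∫ ω₀', G θ ω₀' ∂μ₀‖ ^ 2 ∂μ₀) ≤ σ ^ 2)
    (N : ℕ) : ∀ (γ : ℕ → ℝ) (_ : ∀ k < N, 0 < γ k)
    (_ : ∀ k < N, γ k * (L * (1 + δ) ^ 2) ≤ 1 - δ) (θ : H)
    (θs : ℕ → (Fin N → Ω₀) → H) (_ : ∀ ω, θs 0 ω = θ)
    (_ : ∀ k (h : k < N) ω, θs (k + 1) ω = θs k ω - γ k • G (θs k ω) (ω ⟨k, h⟩)),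
    ∫⁻ ω, ∑ k ∈ Finset.range N, ENNReal.ofReal (γ k * ‖g (θs k ω)‖ ^ 2)
        ∂(Measure.pi fun _ : Fin N => μ₀) ≤
      ENNReal.ofReal ((2 * (ℒ θ - lstar) + L * σ ^ 2 * ∑ k ∈ Finset.range N, γ k ^ 2)
        / (1 - δ)) := by
  induction N with
  | zero => intros; simp
  | succ N ih =>
    intro γ hpos hle θ θs h0 hs
    have mp := (measurePreserving_piFinSuccAbove (fun _ : Fin (N + 1) => μ₀) 0).symm
    rw [← mp.lintegral_comp_emb (MeasurableEquiv.measurableEmbedding _)]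
    refine (lintegral_prod_le _).trans ?_
    have hC : 0 ≤ L * σ ^ 2 * ∑ k ∈ Finset.range N, γ (k + 1) ^ 2 := by positivity
    have key := sgd_step ℒ g L hL hgrad hLip lstar hbelow δ hδ σ μ₀ G hG_int hG_sq hbias hvar
      (γ 0) (hpos 0 (by omega)) (hle 0 (by omega)) _ hC θ
    have e : L * σ ^ 2 * γ 0 ^ 2 + L * σ ^ 2 * ∑ k ∈ Finset.range N, γ (k + 1) ^ 2
        = L * σ ^ 2 * ∑ k ∈ Finset.range (N + 1), γ k ^ 2 := by
      rw [Finset.sum_range_succ']; ring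
    rw [e] at key
    refine le_trans ?_ key
    calc _ ≤ ∫⁻ x, (ENNReal.ofReal (γ 0 * ‖g θ‖ ^ 2) + ENNReal.ofReal
          ((2 * (ℒ (θ - γ 0 • G θ x) - lstar)
            + L * σ ^ 2 * ∑ k ∈ Finset.range N, γ (k + 1) ^ 2) / (1 - δ))) ∂μ₀ := by
          apply lintegral_mono
          intro x
          have := ih (fun k => γ (k + 1)) (fun k hk => hpos _ (by omega))
            (fun k hk => hle _ (by omega)) (θ - γ 0 • G θ x)
            (fun k ω => θs (k + 1) (Fin.cons x ω))
            (fun ω => by rw [hs 0 (by omega), h0]; rfl)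
            (fun k hk ω => by
              rw [hs (k + 1) (by omega)]; rfl)
          refine le_trans (le_of_eq ?_) (add_le_add_right this _)
          rw [← one_mul (ENNReal.ofReal (γ 0 * ‖g θ‖ ^ 2))]
          nth_rw 1 [← measure_univ (μ := Measure.pi fun _ : Fin N => μ₀)]
          rw [mul_comm, ← lintegral_const, ← lintegral_add_left measurable_const]
          apply lintegral_congr
          intro ω
          have hcons : (MeasurableEquiv.piFinSuccAbove (fun _ : Fin (N + 1) => Ω₀) 0).symm (x, ω)
              = Fin.cons x ω := Fin.insertNth_zero' x ω
          rw [hcons, Finset.sum_range_succ', add_comm, h0]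
      _ = _ := by
          rw [lintegral_add_left measurable_const]
          simp

/-- Decaying-stepsize corollary of Theorem 2: with stepsizes `γ_n = γ·n^{−1/2}`
and `0 < γ ≤ (1−δ)/(L(1+δ)²)`, SGD with a `δ`-relatively-biased,
`σ²`-variance-bounded stochastic gradient oracle satisfies
`E[min_{1 ≤ n ≤ N+1} ‖g(θ_n)‖²] ≤ (2D + Lσ²γ²(1+log N))/((1−δ)γ√N)`. -/
theorem sgd_biased_gradients_decaying_stepsize
    {H : Type*} [NormedAddCommGroup H] [InnerProductSpace ℝ H]
    [MeasurableSpace H] [BorelSpace H]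
    (ℒ : H → ℝ) (g : H → H) (L : ℝ)
    (hgrad : ∀ θ, HasFDerivAt ℒ ((InnerProductSpace.toDualMap ℝ H) (g θ)) θ)
    (hLip : ∀ θ θ', ‖g θ - g θ'‖ ≤ L * ‖θ - θ'‖)
    (lstar : ℝ) (hbelow : ∀ θ, lstar ≤ ℒ θ)
    (δ : ℝ) (hδ : δ ∈ Set.Ico (0 : ℝ) 1) (σ : ℝ) (hσ : 0 ≤ σ)
    {Ω₀ : Type*} [MeasurableSpace Ω₀] (μ₀ : Measure Ω₀) [IsProbabilityMeasure μ₀]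
    (G : H → Ω₀ → H) (hG_meas : Measurable (Function.uncurry G))
    (hG_int : ∀ θ, Integrable (G θ) μ₀)
    (hG_sq : ∀ θ, Integrable (fun ω₀ => ‖G θ ω₀‖ ^ 2) μ₀)
    (hbias : ∀ θ, ‖(∫ ω₀, G θ ω₀ ∂μ₀) - g θ‖ ≤ δ * ‖g θ‖)
    (hvar : ∀ θ, (∫ ω₀, ‖G θ ω₀ - ∫ ω₀', G θ ω₀' ∂μ₀‖ ^ 2 ∂μ₀) ≤ σ ^ 2)
    (N : ℕ) (hN : 0 < N) (θ₁ : H)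
    (D : ℝ) (hD : D = ℒ θ₁ - lstar)
    (γ : ℝ) (hγ_pos : 0 < γ) (hγ_le : γ ≤ (1 - δ) / (L * (1 + δ) ^ 2))
    (γseq : ℕ → ℝ) (hγseq : ∀ n, 1 ≤ n → n ≤ N → γseq n = γ / Real.sqrt n)
    (θseq : ℕ → (Fin N → Ω₀) → H)
    (hθ_init : ∀ ω, θseq 1 ω = θ₁)
    (hθ_step : ∀ n (h1 : 1 ≤ n) (h2 : n ≤ N), ∀ ω : Fin N → Ω₀,
      θseq (n + 1) ω = θseq n ω - γseq n • G (θseq n ω) (ω ⟨n - 1, by omega⟩)) :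
    (∫ ω, ((Finset.Icc 1 (N + 1)).inf' (Finset.nonempty_Icc.mpr (by omega))
        fun n => ‖g (θseq n ω)‖ ^ 2) ∂(Measure.pi fun _ : Fin N => μ₀)) ≤
      (2 * D + L * σ ^ 2 * γ ^ 2 * (1 + Real.log N)) /
        ((1 - δ) * γ * Real.sqrt N) := by
  classical
  have h1δ : 0 < 1 - δ := by linarith [hδ.2]
  have hL : 0 < L := by
    by_contra hL
    have : (1 - δ) / (L * (1 + δ) ^ 2) ≤ 0 :=
      div_nonpos_of_nonneg_of_nonpos h1δ.le
        (mul_nonpos_of_nonpos_of_nonneg (not_lt.1 hL) (sq_nonneg _))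
    linarith
  have hD0 : 0 ≤ D := by rw [hD]; linarith [hbelow θ₁]
  have hN1 : (1 : ℝ) ≤ N := by exact_mod_cast hN
  have hlog : 0 ≤ Real.log N := Real.log_nonneg hN1
  have hsN : 0 < Real.sqrt N := Real.sqrt_pos.2 (by linarith)
  have hR : 0 ≤ (2 * D + L * σ ^ 2 * γ ^ 2 * (1 + Real.log N)) /
        ((1 - δ) * γ * Real.sqrt N) := by positivity
  set F : (Fin N → Ω₀) → ℝ := fun ω =>
    (Finset.Icc 1 (N + 1)).inf' (Finset.nonempty_Icc.mpr (by omega))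
        fun n => ‖g (θseq n ω)‖ ^ 2 with hF
  have hF0 : ∀ ω, 0 ≤ F ω := fun ω => by
    apply Finset.le_inf'
    intro n _
    positivity
  have hFle : ∀ ω n, 1 ≤ n → n ≤ N + 1 → F ω ≤ ‖g (θseq n ω)‖ ^ 2 := fun ω n h1 h2 =>
    Finset.inf'_le _ (Finset.mem_Icc.2 ⟨h1, h2⟩)
  by_cases hc : CompleteSpace H
  swap
  · have hg : ∀ θ, g θ = 0 := by
      intro θ
      have := hbias θ
      rw [integral, dif_neg hc, zero_sub, norm_neg] at this
      have h3 := norm_nonneg (g θ)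
      rw [← norm_eq_zero]
      nlinarith
    have : ∀ ω, F ω = 0 := fun ω => le_antisymm
      ((hFle ω 1 le_rfl (by omega)).trans (by simp [hg])) (hF0 ω)
    have hFz : F = fun _ => 0 := funext this
    refine le_trans (le_of_eq ?_) hR
    change ∫ ω, F ω ∂_ = 0
    rw [hFz]
    simp
  by_cases hm : AEStronglyMeasurable F (Measure.pi fun _ : Fin N => μ₀)
  swap
  · rw [integral_undef (fun h => hm h.1)]
    exact hR
  have hγle' : γ * (L * (1 + δ) ^ 2) ≤ 1 - δ := by
    have : 0 < L * (1 + δ) ^ 2 := by have := hδ.1; positivity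
    rwa [le_div_iff₀ this] at hγ_le
  have hg1 : ∀ k < N, γseq (k + 1) = γ / Real.sqrt ((k : ℝ) + 1) := fun k hk => by
    rw [hγseq (k + 1) (by omega) (by omega)]; push_cast; rfl
  have hpos : ∀ k < N, 0 < γseq (k + 1) := fun k hk => by rw [hg1 k hk]; positivity
  have hleγ : ∀ k < N, γseq (k + 1) ≤ γ := fun k hk => by
    rw [hg1 k hk]
    apply div_le_self hγ_pos.le
    rw [Real.one_le_sqrt]
    linarith [Nat.cast_nonneg (α := ℝ) k]
  have main := sgd_main ℒ g L hL hgrad hLip lstar hbelow δ hδ σ μ₀ G hG_int hG_sq hbias hvar N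
    (fun k => γseq (k + 1)) hpos
    (fun k hk => le_trans (mul_le_mul_of_nonneg_right (hleγ k hk)
      (mul_nonneg hL.le (sq_nonneg _))) hγle')
    θ₁ (fun k => θseq (k + 1)) hθ_init
    (fun k hk ω => by
      have := hθ_step (k + 1) (by omega) (by omega) ω
      simpa using this)
  have hsum1 : γ * Real.sqrt N ≤ ∑ k ∈ Finset.range N, γseq (k + 1) := by
    have h : ∀ k ∈ Finset.range N, γ / Real.sqrt N ≤ γseq (k + 1) := fun k hk => by
      rw [Finset.mem_range] at hk
      rw [hg1 k hk]
      have : (k : ℝ) + 1 ≤ N := by exact_mod_cast hk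
      gcongr
    have h2 := Finset.card_nsmul_le_sum _ _ _ h
    rw [Finset.card_range, nsmul_eq_mul] at h2
    refine le_trans (le_of_eq ?_) h2
    field_simp
    rw [Real.sq_sqrt (by linarith)]
  have hsum2 : ∑ k ∈ Finset.range N, γseq (k + 1) ^ 2 ≤ γ ^ 2 * (1 + Real.log N) := by
    have h := harmonic_le_one_add_log N
    refine le_trans (le_of_eq ?_) (mul_le_mul_of_nonneg_left h (sq_nonneg γ))
    rw [harmonic]
    push_cast
    rw [Finset.mul_sum]
    refine Finset.sum_congr rfl fun k hk => ?_
    rw [hg1 k (Finset.mem_range.1 hk), div_pow, Real.sq_sqrt (by positivity), div_eq_mul_inv]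
  have hint : (∫ ω, F ω * (γ * Real.sqrt N) ∂(Measure.pi fun _ : Fin N => μ₀)) ≤
      (2 * D + L * σ ^ 2 * γ ^ 2 * (1 + Real.log N)) / (1 - δ) := by
    rw [integral_eq_lintegral_of_nonneg_ae
      (Filter.Eventually.of_forall fun ω => mul_nonneg (hF0 ω) (by positivity))
      (hm.mul_const _)]
    refine ENNReal.toReal_le_of_le_ofReal (by positivity) ?_
    refine le_trans (lintegral_mono fun ω => ?_) (main.trans (ENNReal.ofReal_le_ofReal ?_))
    · rw [← ENNReal.ofReal_sum_of_nonneg fun k hk =>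
        mul_nonneg (hpos k (Finset.mem_range.1 hk)).le (sq_nonneg _)]
      apply ENNReal.ofReal_le_ofReal
      refine (mul_le_mul_of_nonneg_left hsum1 (hF0 ω)).trans ?_
      rw [Finset.mul_sum]
      refine Finset.sum_le_sum fun k hk => ?_
      rw [Finset.mem_range] at hk
      rw [mul_comm]
      exact mul_le_mul_of_nonneg_left (hFle ω _ (by omega) (by omega)) (hpos k hk).le
    · rw [← hD]
      have := mul_le_mul_of_nonneg_left hsum2 (by positivity : 0 ≤ L * σ ^ 2)
      apply div_le_div_of_nonneg_right _ h1δ.le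
      linarith
  rw [integral_mul_const, ← le_div_iff₀ (by positivity), div_div, ← mul_assoc] at hint
  exact hint
end
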